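/- Fix n ≥ 2 and k ≥ 1. The space CDiam_n(k) of configurations of k causally disjoint rectilinear causal diamonds in the standard diamond and the space Disc_{n-1}(k) of configurations of k little (n−1)-discs with disjoint interiors are homotopy equivalent topological spaces. -/

import Mathlib

open Set Metric unitInterval

noncomputable section

/-- `n`-dimensional Minkowski space, modeled as `ℝⁿ` with the Euclidean norm. -/
abbrev Mink (n : ℕ) := EuclideanSpace ℝ (Fin n)

/-- The spatial part `x⃗ = (x 1, …, x (n-1)) ∈ ℝ^{n-1}` of `x ∈ ℝⁿ`. -/
def spatial {n : ℕ} (x : Mink n) : Mink (n - 1) :=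
  (WithLp.equiv 2 _).symm fun i : Fin (n - 1) => x ⟨i.1 + 1, by have := i.isLt; omega⟩

/-- A curve `γ` is future-directed causal if it is `C¹` and
`(γ₀)'(t) ≥ ‖(γ⃗)'(t)‖` for all `t ∈ [0,1]`. -/
def FDCausal {n : ℕ} [NeZero n] (γ : ℝ → Mink n) : Prop :=
  ContDiff ℝ 1 γ ∧
    ∀ t ∈ Set.Icc (0 : ℝ) 1,
      ‖deriv (fun s => spatial (γ s)) t‖ ≤ deriv (fun s => γ s 0) t

/-- A curve `γ` is past-directed causal if it is `C¹` and
`-(γ₀)'(t) ≥ ‖(γ⃗)'(t)‖` for all `t ∈ [0,1]`. -/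
def PDCausal {n : ℕ} [NeZero n] (γ : ℝ → Mink n) : Prop :=
  ContDiff ℝ 1 γ ∧
    ∀ t ∈ Set.Icc (0 : ℝ) 1,
      ‖deriv (fun s => spatial (γ s)) t‖ ≤ -(deriv (fun s => γ s 0) t)

/-- A causal curve is a future- or past-directed causal curve. -/
def IsCausalCurve {n : ℕ} [NeZero n] (γ : ℝ → Mink n) : Prop :=
  FDCausal γ ∨ PDCausal γ

/-- `S` and `T` are causally disjoint if no causal curve starts in `S` and ends in `T`. -/
def CausallyDisjoint {n : ℕ} [NeZero n] (S T : Set (Mink n)) : Prop :=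
  ¬ ∃ γ : ℝ → Mink n, IsCausalCurve γ ∧ γ 0 ∈ S ∧ γ 1 ∈ T

/-- The open causal diamond `◊(b, r) = {x : |x₀ - b₀| + ‖x⃗ - b⃗‖ < r}`. -/
def diamond {n : ℕ} [NeZero n] (b : Mink n) (r : ℝ) : Set (Mink n) :=
  {x | |x 0 - b 0| + ‖spatial x - spatial b‖ < r}

/-- The space `CDiam_n(k)` of `k` causally disjoint rectilinear causal diamonds in the
standard diamond, recorded as tuples of (radius, center). -/
def CDiamSet (n : ℕ) [NeZero n] (k : ℕ) : Set (Fin k → ℝ × Mink n) :=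
  {f | (∀ i, 0 < (f i).1 ∧ (f i).1 + |(f i).2 0| + ‖spatial (f i).2‖ ≤ 1) ∧
    ∀ i j, i ≠ j →
      CausallyDisjoint (diamond (f i).2 (f i).1) (diamond (f j).2 (f j).1)}

/-- The space `Disc_m(k)` of `k` little `m`-discs with disjoint interiors,
recorded as tuples of (radius, center). -/
def DiscSet (m k : ℕ) : Set (Fin k → ℝ × Mink m) :=
  {f | (∀ i, 0 < (f i).1 ∧ (f i).1 + ‖(f i).2‖ ≤ 1) ∧
    ∀ i j, i ≠ j →
      Disjoint (ball (f i).2 (f i).1) (ball (f j).2 (f j).1)}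

/-- The vector of Minkowski space with time coordinate `t` and spatial part `c`. -/
def timeSpace {n : ℕ} [NeZero n] (t : ℝ) (c : Mink (n - 1)) : Mink n :=
  WithLp.toLp 2 fun i : Fin n =>
    if h : i = 0 then t
    else c ⟨i.1 - 1, by
      have : i.1 ≠ 0 := fun h' => h (Fin.ext (by simpa using h'))
      omega⟩

@[simp] lemma timeSpace_zero {n : ℕ} [NeZero n] (t : ℝ) (c : Mink (n - 1)) :
    timeSpace (n := n) t c 0 = t := by
  simp [timeSpace]

@[simp] lemma spatial_timeSpace {n : ℕ} [NeZero n] (t : ℝ) (c : Mink (n - 1)) :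
    spatial (timeSpace (n := n) t c) = c := by
  ext i
  simp [spatial, timeSpace]

@[simp] lemma timeSpace_spatial {n : ℕ} [NeZero n] (x : Mink n) :
    timeSpace (x 0) (spatial x) = x := by
  ext i
  by_cases h : i = 0
  · subst h; simp
  · have h' : i.1 ≠ 0 := fun h' => h (Fin.ext (by simpa using h'))
    have : (⟨i.1 - 1 + 1, by have := i.isLt; omega⟩ : Fin n) = i := Fin.ext (by simp; omega)
    simp [spatial, timeSpace, h, this]

lemma continuous_timeSpace {n : ℕ} [NeZero n] :
    Continuous fun p : ℝ × Mink (n - 1) => timeSpace (n := n) p.1 p.2 := by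
  refine (PiLp.continuous_toLp 2 _).comp (continuous_pi fun i => ?_)
  by_cases h : i = 0
  · simpa [h] using continuous_fst
  · simp only [h, dite_false]
    fun_prop

/-- The spatial part as a continuous linear map. -/
def spatialCLM (n : ℕ) : Mink n →L[ℝ] Mink (n - 1) :=
  LinearMap.toContinuousLinearMap
    { toFun := spatial
      map_add' := fun _ _ => rfl
      map_smul' := fun _ _ => rfl }

lemma spatialCLM_apply {n : ℕ} (x : Mink n) : spatialCLM n x = spatial x := rfl

lemma continuous_spatial {n : ℕ} : Continuous (spatial : Mink n → Mink (n - 1)) :=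
  (spatialCLM n).continuous

lemma FDCausal.norm_spatial_sub_le {n : ℕ} [NeZero n] {γ : ℝ → Mink n} (h : FDCausal γ) :
    ‖spatial (γ 1) - spatial (γ 0)‖ ≤ γ 1 0 - γ 0 0 := by
  have hγ : Differentiable ℝ γ := h.1.differentiable one_ne_zero
  have hs : Differentiable ℝ fun s => spatial (γ s) := (spatialCLM n).differentiable.comp hγ
  have ht : Differentiable ℝ fun s => γ s 0 :=
    (EuclideanSpace.proj (𝕜 := ℝ) (0 : Fin n)).differentiable.comp hγ
  exact image_norm_le_of_norm_deriv_right_le_deriv_boundary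
    (f := fun s => spatial (γ s) - spatial (γ 0)) (B := fun s => γ s 0 - γ 0 0)
    (hs.continuous.sub continuous_const).continuousOn
    (fun t _ => ((hs t).hasDerivAt.sub_const _).hasDerivWithinAt) (by simp)
    (fun t => (ht t).hasDerivAt.sub_const _)
    (fun t ht => h.2 t (Ico_subset_Icc_self ht)) (right_mem_Icc.2 zero_le_one)

lemma PDCausal.norm_spatial_sub_le {n : ℕ} [NeZero n] {γ : ℝ → Mink n} (h : PDCausal γ) :
    ‖spatial (γ 1) - spatial (γ 0)‖ ≤ -(γ 1 0 - γ 0 0) := by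
  have hγ : Differentiable ℝ γ := h.1.differentiable one_ne_zero
  have hs : Differentiable ℝ fun s => spatial (γ s) := (spatialCLM n).differentiable.comp hγ
  have ht : Differentiable ℝ fun s => γ s 0 :=
    (EuclideanSpace.proj (𝕜 := ℝ) (0 : Fin n)).differentiable.comp hγ
  exact image_norm_le_of_norm_deriv_right_le_deriv_boundary
    (f := fun s => spatial (γ s) - spatial (γ 0)) (B := fun s => -(γ s 0 - γ 0 0))
    (hs.continuous.sub continuous_const).continuousOn
    (fun t _ => ((hs t).hasDerivAt.sub_const _).hasDerivWithinAt) (by simp)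
    (fun t => ((ht t).hasDerivAt.sub_const _).neg)
    (fun t ht => h.2 t (Ico_subset_Icc_self ht)) (right_mem_Icc.2 zero_le_one)

lemma IsCausalCurve.norm_spatial_sub_le {n : ℕ} [NeZero n] {γ : ℝ → Mink n}
    (h : IsCausalCurve γ) : ‖spatial (γ 1) - spatial (γ 0)‖ ≤ |γ 1 0 - γ 0 0| :=
  h.elim (fun h => h.norm_spatial_sub_le.trans (le_abs_self _))
    fun h => h.norm_spatial_sub_le.trans (neg_le_abs _)

lemma isCausalCurve_segment {n : ℕ} [NeZero n] {x y : Mink n}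
    (h : ‖spatial y - spatial x‖ ≤ |y 0 - x 0|) :
    IsCausalCurve fun s : ℝ => x + s • (y - x) := by
  have hγ (t : ℝ) : HasDerivAt (fun s : ℝ => x + s • (y - x)) (y - x) t := by
    simpa using ((hasDerivAt_id t).smul_const (y - x)).const_add x
  have hs (t : ℝ) : deriv (fun s : ℝ => spatial (x + s • (y - x))) t = spatial y - spatial x :=
    ((spatialCLM n).hasFDerivAt.comp_hasDerivAt t (hγ t)).deriv
  have ht (t : ℝ) : deriv (fun s : ℝ => (x + s • (y - x)) 0) t = y 0 - x 0 :=
    ((EuclideanSpace.proj (𝕜 := ℝ) (0 : Fin n)).hasFDerivAt.comp_hasDerivAt t (hγ t)).deriv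
  have hc : ContDiff ℝ 1 fun s : ℝ => x + s • (y - x) := by fun_prop
  rcases abs_choice (y 0 - x 0) with h' | h' <;> rw [h'] at h
  · exact Or.inl ⟨hc, fun t _ => by rw [hs, ht]; exact h⟩
  · exact Or.inr ⟨hc, fun t _ => by rw [hs, ht]; exact h⟩

/-- Sets are causally disjoint iff all their pairs of points are spacelike separated. -/
lemma causallyDisjoint_iff {n : ℕ} [NeZero n] {S T : Set (Mink n)} :
    CausallyDisjoint S T ↔ ∀ x ∈ S, ∀ y ∈ T, |y 0 - x 0| < ‖spatial y - spatial x‖ := by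
  refine ⟨fun h x hx y hy => ?_, fun h ⟨γ, hγ, h0, h1⟩ =>
    (h _ h0 _ h1).not_ge hγ.norm_spatial_sub_le⟩
  by_contra! hxy
  exact h ⟨_, isCausalCurve_segment hxy, by simpa using hx, by simpa using hy⟩

lemma causallyDisjoint_diamond_iff {n : ℕ} [NeZero n] {b b' : Mink n} {r r' : ℝ}
    (hr : 0 < r) (hr' : 0 < r') :
    CausallyDisjoint (diamond b r) (diamond b' r') ↔
      r + r' + |b 0 - b' 0| ≤ ‖spatial b - spatial b'‖ := by
  rw [causallyDisjoint_iff]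
  constructor
  · intro h
    by_contra! hlt
    set R := r + r' + |b 0 - b' 0| with hR
    have hR0 : 0 < R := by positivity
    set v := spatial b - spatial b' with hv
    have hlt' : ‖v‖ / R < 1 := (div_lt_one hR0).2 hlt
    have hx : timeSpace (b 0) (spatial b - (r / R) • v) ∈ diamond b r := by
      have : r / R * ‖v‖ < r := by
        rw [div_mul_eq_mul_div, mul_div_assoc]; exact mul_lt_of_lt_one_right hr hlt'
      simpa [diamond, norm_smul, abs_of_pos hr, abs_of_pos hR0] using this
    have hy : timeSpace (b' 0) (spatial b' + (r' / R) • v) ∈ diamond b' r' := by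
      have : r' / R * ‖v‖ < r' := by
        rw [div_mul_eq_mul_div, mul_div_assoc]; exact mul_lt_of_lt_one_right hr' hlt'
      simpa [diamond, norm_smul, abs_of_pos hr', abs_of_pos hR0] using this
    have key := h _ hx _ hy
    have e : spatial b' + (r' / R) • v - (spatial b - (r / R) • v)
        = -((|b 0 - b' 0| / R) • v) := by
      have h1 : |b 0 - b' 0| / R = 1 - r / R - r' / R := by
        field_simp; rw [hR]; ring
      rw [h1, sub_smul, sub_smul, one_smul, hv]
      abel
    rw [timeSpace_zero, timeSpace_zero, spatial_timeSpace, spatial_timeSpace, e, norm_neg,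
      norm_smul, Real.norm_of_nonneg (by positivity), abs_sub_comm, div_mul_eq_mul_div,
      mul_div_assoc] at key
    exact key.not_ge (mul_le_of_le_one_right (abs_nonneg _) hlt'.le)
  · intro h x hx y hy
    have hx' : |x 0 - b 0| + ‖spatial x - spatial b‖ < r := hx
    have hy' : |y 0 - b' 0| + ‖spatial y - spatial b'‖ < r' := hy
    have h1 : ‖spatial b - spatial b'‖ ≤ ‖spatial y - spatial x‖ +
        ‖spatial x - spatial b‖ + ‖spatial y - spatial b'‖ := by
      have : spatial b - spatial b' = -(spatial y - spatial x) - (spatial x - spatial b) +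
          (spatial y - spatial b') := by abel
      rw [this]
      refine (norm_add_le _ _).trans (add_le_add_left ((norm_sub_le _ _).trans ?_) _)
      rw [norm_neg]
    have h2 : |y 0 - x 0| ≤ |b 0 - b' 0| + |x 0 - b 0| + |y 0 - b' 0| := by
      grind
    linarith

lemma mem_CDiamSet_iff {n k : ℕ} [NeZero n] {f : Fin k → ℝ × Mink n} :
    f ∈ CDiamSet n k ↔ (∀ i, 0 < (f i).1 ∧ (f i).1 + |(f i).2 0| + ‖spatial (f i).2‖ ≤ 1) ∧
      ∀ i j, i ≠ j → (f i).1 + (f j).1 + |(f i).2 0 - (f j).2 0| ≤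
        ‖spatial (f i).2 - spatial (f j).2‖ :=
  and_congr_right fun h => forall₃_congr fun i j _ =>
    causallyDisjoint_diamond_iff (h i).1 (h j).1

lemma mem_DiscSet_iff {m k : ℕ} {f : Fin k → ℝ × Mink m} :
    f ∈ DiscSet m k ↔ (∀ i, 0 < (f i).1 ∧ (f i).1 + ‖(f i).2‖ ≤ 1) ∧
      ∀ i j, i ≠ j → (f i).1 + (f j).1 ≤ ‖(f i).2 - (f j).2‖ :=
  and_congr_right fun h => forall₃_congr fun i j _ => by
    rw [disjoint_ball_ball_iff (h i).1 (h j).1, dist_eq_norm]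

lemma continuous_coe_apply {k : ℕ} {E : Type*} [TopologicalSpace E] {S : Set (Fin k → E)}
    (i : Fin k) : Continuous fun f : S => f.1 i :=
  (continuous_apply i).comp continuous_subtype_val

/-- Forgetting the time coordinates of the centers. -/
def forgetTime (n k : ℕ) [NeZero n] : C(CDiamSet n k, DiscSet (n - 1) k) where
  toFun f := ⟨fun i => ((f.1 i).1, spatial (f.1 i).2), by
    obtain ⟨h1, h2⟩ := mem_CDiamSet_iff.1 f.2
    refine mem_DiscSet_iff.2 ⟨fun i => ⟨(h1 i).1, ?_⟩, fun i j hij => ?_⟩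
    · linarith [(h1 i).2, abs_nonneg ((f.1 i).2 0)]
    · linarith [h2 i j hij, abs_nonneg ((f.1 i).2 0 - (f.1 j).2 0)]⟩
  continuous_toFun := by
    refine Continuous.subtype_mk (continuous_pi fun i => ?_) _
    have hi := continuous_coe_apply (S := CDiamSet n k) i
    exact hi.fst.prodMk (continuous_spatial.comp hi.snd)

/-- Placing discs in the time-zero slice. -/
def timeZeroSlice (n k : ℕ) [NeZero n] : C(DiscSet (n - 1) k, CDiamSet n k) where
  toFun f := ⟨fun i => ((f.1 i).1, timeSpace 0 (f.1 i).2), by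
    simpa [mem_CDiamSet_iff] using mem_DiscSet_iff.1 f.2⟩
  continuous_toFun := by
    refine Continuous.subtype_mk (continuous_pi fun i => ?_) _
    have hi := continuous_coe_apply (S := DiscSet (n - 1) k) i
    exact hi.fst.prodMk (continuous_timeSpace.comp (continuous_const.prodMk hi.snd))

/-- Rescaling all time coordinates deforms the time-zero slice retraction to the identity. -/
def rescaleTime (n k : ℕ) [NeZero n] :
    ((timeZeroSlice n k).comp (forgetTime n k)).Homotopy (ContinuousMap.id (CDiamSet n k)) where
  toFun p := ⟨fun i => ((p.2.1 i).1,
      timeSpace ((p.1 : ℝ) * (p.2.1 i).2 0) (spatial (p.2.1 i).2)), by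
    obtain ⟨h1, h2⟩ := mem_CDiamSet_iff.1 p.2.2
    have hs (a : ℝ) : |(p.1 : ℝ) * a| ≤ |a| := by
      rw [abs_mul, abs_of_nonneg p.1.2.1]
      exact mul_le_of_le_one_left (abs_nonneg a) p.1.2.2
    refine mem_CDiamSet_iff.2 ⟨fun i => ⟨(h1 i).1, ?_⟩, fun i j hij => ?_⟩
    · simp only [timeSpace_zero, spatial_timeSpace]
      linarith [(h1 i).2, hs ((p.2.1 i).2 0)]
    · simp only [timeSpace_zero, spatial_timeSpace, ← mul_sub]
      linarith [h2 i j hij, hs ((p.2.1 i).2 0 - (p.2.1 j).2 0)]⟩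
  continuous_toFun := by
    refine Continuous.subtype_mk (continuous_pi fun i => ?_) _
    have hi := (continuous_coe_apply (S := CDiamSet n k) i).comp
      (continuous_snd (X := unitInterval))
    have ht := (EuclideanSpace.proj (𝕜 := ℝ) (0 : Fin n)).continuous.comp hi.snd
    exact hi.fst.prodMk (continuous_timeSpace.comp
      (((continuous_subtype_val.comp continuous_fst).mul ht).prodMk
        (continuous_spatial.comp hi.snd)))
  map_zero_left f := by
    ext1
    simp [timeZeroSlice, forgetTime]
  map_one_left f := by
    ext1
    simp

/-- The spaces `CDiam_n(k)` and `Disc_{n-1}(k)` are homotopy equivalent. -/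
theorem cdiam_homotopyEquiv_disc (n k : ℕ) [NeZero n] (hn : 2 ≤ n) (hk : 1 ≤ k) :
    Nonempty (ContinuousMap.HomotopyEquiv (CDiamSet n k) (DiscSet (n - 1) k)) := by
  refine ⟨⟨forgetTime n k, timeZeroSlice n k, ⟨rescaleTime n k⟩, ?_⟩⟩
  have h : (forgetTime n k).comp (timeZeroSlice n k) = ContinuousMap.id _ := by
    ext1 f
    ext1
    simp [forgetTime, timeZeroSlice]
  rw [h]
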